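/- Let A₁, A₂, A₃, A₄ be pairwise transverse affine parabolic spaces in 𝔰𝔩ₙ(ℝ) with directions V₁, V₂, V₃, V₄. Then the intersections A₁ ∩ A₃ and A₂ ∩ A₄ are nonempty, and the value β(A₁,A₂,A₃,A₄) = (ν*_{1,4} − ν*_{2,3})(X₁,₃ − X₂,₄) is independent both of the choice of points X₁,₃ ∈ A₁ ∩ A₃ and X₂,₄ ∈ A₂ ∩ A₄ and of the choice of standardizers of (V₁,V₄) and (V₂,V₃); hence the affine cross ratio is well defined. -/

import Mathlib

open Matrix

noncomputable section

abbrev Mn (n : ℕ) := Matrix (Fin n) (Fin n) ℝ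

/-- Conjugation `Z ↦ g Z g⁻¹` as a linear map on matrices. -/
def AdM {n : ℕ} (g : Mn n) : Mn n →ₗ[ℝ] Mn n where
  toFun Z := g * Z * g⁻¹
  map_add' X Y := by simp [Matrix.add_mul, Matrix.mul_add]
  map_smul' c X := by simp [Matrix.smul_mul, Matrix.mul_smul]

/-- Projection onto the diagonal part. -/
def pi0 {n : ℕ} : Mn n →ₗ[ℝ] Mn n where
  toFun Z := Matrix.diagonal (fun i => Z i i)
  map_add' X Y := by
    ext i j
    by_cases h : i = j <;> simp [Matrix.diagonal_apply, h]
  map_smul' c X := by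
    ext i j
    by_cases h : i = j <;> simp [Matrix.diagonal_apply, h]

/-- The involution reversing the diagonal entries (on diagonal matrices). -/
def omega0 {n : ℕ} : Mn n →ₗ[ℝ] Mn n where
  toFun Z := Matrix.diagonal (fun i => Z i.rev i.rev)
  map_add' X Y := by
    ext i j
    by_cases h : i = j <;> simp [Matrix.diagonal_apply, h]
  map_smul' c X := by
    ext i j
    by_cases h : i = j <;> simp [Matrix.diagonal_apply, h]

/-- Traceless matrices: 𝔰𝔩ₙ(ℝ). -/
def slSub (n : ℕ) : Submodule ℝ (Mn n) := LinearMap.ker (Matrix.traceLinearMap (Fin n) ℝ ℝ)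

/-- Matrices vanishing below the diagonal (upper triangular). -/
def upTri (n : ℕ) : Submodule ℝ (Mn n) where
  carrier := {Z | ∀ i j : Fin n, j < i → Z i j = 0}
  add_mem' := by intro a b ha hb i j h; simp [Matrix.add_apply, ha i j h, hb i j h]
  zero_mem' := by intro i j h; rfl
  smul_mem' := by intro c a ha i j h; simp [Matrix.smul_apply, ha i j h]

/-- Matrices vanishing above the diagonal (lower triangular). -/
def loTri (n : ℕ) : Submodule ℝ (Mn n) where
  carrier := {Z | ∀ i j : Fin n, i < j → Z i j = 0}
  add_mem' := by intro a b ha hb i j h; simp [Matrix.add_apply, ha i j h, hb i j h]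
  zero_mem' := by intro i j h; rfl
  smul_mem' := by intro c a ha i j h; simp [Matrix.smul_apply, ha i j h]

/-- Diagonal matrices. -/
def diagSub (n : ℕ) : Submodule ℝ (Mn n) where
  carrier := {Z | ∀ i j : Fin n, i ≠ j → Z i j = 0}
  add_mem' := by intro a b ha hb i j h; simp [Matrix.add_apply, ha i j h, hb i j h]
  zero_mem' := by intro i j h; rfl
  smul_mem' := by intro c a ha i j h; simp [Matrix.smul_apply, ha i j h]

/-- Strictly upper triangular matrices: 𝔫⁺. -/
def nplus (n : ℕ) : Submodule ℝ (Mn n) where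
  carrier := {Z | ∀ i j : Fin n, j ≤ i → Z i j = 0}
  add_mem' := by intro a b ha hb i j h; simp [Matrix.add_apply, ha i j h, hb i j h]
  zero_mem' := by intro i j h; rfl
  smul_mem' := by intro c a ha i j h; simp [Matrix.smul_apply, ha i j h]

/-- Strictly lower triangular matrices: 𝔫⁻. -/
def nminus (n : ℕ) : Submodule ℝ (Mn n) where
  carrier := {Z | ∀ i j : Fin n, i ≤ j → Z i j = 0}
  add_mem' := by intro a b ha hb i j h; simp [Matrix.add_apply, ha i j h, hb i j h]
  zero_mem' := by intro i j h; rfl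
  smul_mem' := by intro c a ha i j h; simp [Matrix.smul_apply, ha i j h]

/-- 𝔟⁺ : traceless upper triangular matrices. -/
def bplus (n : ℕ) : Submodule ℝ (Mn n) := slSub n ⊓ upTri n

/-- 𝔟⁻ : traceless lower triangular matrices. -/
def bminus (n : ℕ) : Submodule ℝ (Mn n) := slSub n ⊓ loTri n

/-- 𝔞 : traceless diagonal matrices. -/
def aSub (n : ℕ) : Submodule ℝ (Mn n) := slSub n ⊓ diagSub n

/-- A parabolic subspace of 𝔰𝔩ₙ(ℝ): a subspace of the form Ad(g)𝔟⁺ with g ∈ SLₙ(ℝ). -/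
def IsParabolic {n : ℕ} (V : Submodule ℝ (Mn n)) : Prop :=
  ∃ g : Mn n, g.det = 1 ∧ V = (bplus n).map (AdM g)

/-- Two subspaces are transverse if together they span 𝔰𝔩ₙ(ℝ). -/
def Transv {n : ℕ} (V W : Submodule ℝ (Mn n)) : Prop := V ⊔ W = slSub n

/-- A standardizer of an ordered transverse pair of parabolic subspaces. -/
def IsStd {n : ℕ} (h : Mn n) (V₁ V₂ : Submodule ℝ (Mn n)) : Prop :=
  h.det = 1 ∧ (bplus n).map (AdM h) = V₁ ∧ (bminus n).map (AdM h) = V₂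

/-- ν*_{i,j} computed with the standardizer h. -/
def nustar {n : ℕ} (h : Mn n) : Mn n →ₗ[ℝ] Mn n := pi0 ∘ₗ AdM h⁻¹

/-- ν_{i,j} computed with the standardizer h. -/
def nuMap {n : ℕ} (h : Mn n) : Mn n →ₗ[ℝ] Mn n := AdM h ∘ₗ pi0

/-- π_{i,j} computed with the standardizer h. -/
def piStd {n : ℕ} (h : Mn n) : Mn n →ₗ[ℝ] Mn n := AdM h ∘ₗ pi0 ∘ₗ AdM h⁻¹

/-- The commutator subspace [V,V]. -/
def commSub {n : ℕ} (V : Submodule ℝ (Mn n)) : Submodule ℝ (Mn n) :=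
  Submodule.span ℝ {z | ∃ x ∈ V, ∃ y ∈ V, z = x * y - y * x}

/-- An affine parabolic space with direction V: an affine subspace X + V of 𝔰𝔩ₙ(ℝ)
whose direction V is a parabolic subspace. -/
def IsAffPara {n : ℕ} (A : Set (Mn n)) (V : Submodule ℝ (Mn n)) : Prop :=
  IsParabolic V ∧ ∃ X : Mn n, X ∈ slSub n ∧ A = {Z | Z - X ∈ V}

/-- `IsCross b A₁ A₂ A₃ A₄ V₁ V₂ V₃ V₄` : b is a value of the affine cross ratio
β(A₁,A₂,A₃,A₄), computed with some choice of standardizers and intersection points. -/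
def IsCross {n : ℕ} (b : Mn n) (A₁ A₂ A₃ A₄ : Set (Mn n))
    (V₁ V₂ V₃ V₄ : Submodule ℝ (Mn n)) : Prop :=
  ∃ h₁₄ h₂₃ : Mn n, ∃ X₁₃ X₂₄ : Mn n,
    IsStd h₁₄ V₁ V₄ ∧ IsStd h₂₃ V₂ V₃ ∧ X₁₃ ∈ A₁ ∩ A₃ ∧ X₂₄ ∈ A₂ ∩ A₄ ∧
    b = nustar h₁₄ (X₁₃ - X₂₄) - nustar h₂₃ (X₁₃ - X₂₄)

/-- `IsTriple d A₂ A₃ A₄ V₂ V₃ V₄` : d is a value of the affine triple ratio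
δ(A₂,A₃,A₄), computed with some choice of standardizers and points. -/
def IsTriple {n : ℕ} (d : Mn n) (A₂ A₃ A₄ : Set (Mn n))
    (V₂ V₃ V₄ : Submodule ℝ (Mn n)) : Prop :=
  ∃ h₂₃ h₃₂ h₃₄ h₄₃ h₄₂ h₂₄ : Mn n, ∃ X₂ X₃ X₄ : Mn n,
    IsStd h₂₃ V₂ V₃ ∧ IsStd h₃₂ V₃ V₂ ∧ IsStd h₃₄ V₃ V₄ ∧ IsStd h₄₃ V₄ V₃ ∧
    IsStd h₄₂ V₄ V₂ ∧ IsStd h₂₄ V₂ V₄ ∧ X₂ ∈ A₂ ∧ X₃ ∈ A₃ ∧ X₄ ∈ A₄ ∧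
    d = (nustar h₂₃ (X₂ - X₃) + nustar h₃₂ (X₂ - X₃))
      + (nustar h₃₄ (X₃ - X₄) + nustar h₄₃ (X₃ - X₄))
      + (nustar h₄₂ (X₄ - X₂) + nustar h₂₄ (X₄ - X₂))

/-- The affine action of (g,Y) ∈ SLₙ(ℝ) ⋉ 𝔰𝔩ₙ(ℝ) on 𝔰𝔩ₙ(ℝ). -/
def affMap {n : ℕ} (g Y : Mn n) : Mn n → Mn n := fun Z => g * Z * g⁻¹ + Y

theorem mul_inv_of_det_one {n : ℕ} {g : Mn n} (hg : g.det = 1) : g * g⁻¹ = 1 :=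
  Matrix.mul_nonsing_inv g (by simp [hg])

theorem inv_mul_of_det_one {n : ℕ} {g : Mn n} (hg : g.det = 1) : g⁻¹ * g = 1 :=
  Matrix.nonsing_inv_mul g (by simp [hg])

theorem mem_map_AdM_iff {n : ℕ} {g : Mn n} (hg : g.det = 1) (V : Submodule ℝ (Mn n)) (Z : Mn n) :
    Z ∈ V.map (AdM g) ↔ g⁻¹ * Z * g ∈ V := by
  constructor
  · rintro ⟨Y, hY, rfl⟩
    have : g⁻¹ * (g * Y * g⁻¹) * g = Y := by
      calc g⁻¹ * (g * Y * g⁻¹) * g = (g⁻¹ * g) * Y * (g⁻¹ * g) := by noncomm_ring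
        _ = Y := by simp [inv_mul_of_det_one hg]
    exact this.symm ▸ hY
  · intro h
    refine ⟨_, h, ?_⟩
    calc g * (g⁻¹ * Z * g) * g⁻¹ = (g * g⁻¹) * Z * (g * g⁻¹) := by noncomm_ring
      _ = Z := by simp [mul_inv_of_det_one hg]

theorem nustar_apply {n : ℕ} {h : Mn n} (hh : h.det = 1) (Z : Mn n) :
    nustar h Z = Matrix.diagonal fun i => (h⁻¹ * Z * h) i i := by
  have : h⁻¹⁻¹ = h := Matrix.nonsing_inv_nonsing_inv h (by simp [hh])
  simp [nustar, pi0, AdM, this]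

theorem mem_slSub {n : ℕ} {Z : Mn n} : Z ∈ slSub n ↔ Z.trace = 0 := Iff.rfl

theorem conj_mem_slSub {n : ℕ} {g Z : Mn n} (hg : g.det = 1) (hZ : Z ∈ slSub n) :
    g * Z * g⁻¹ ∈ slSub n := by
  rw [mem_slSub] at *
  rw [Matrix.trace_mul_cycle, inv_mul_of_det_one hg, one_mul, hZ]

theorem toBlock_eq_zero_of_mem_upTri {n : ℕ} {S : Fin n → Prop} (hS : Monotone S) {U : Mn n}
    (hU : U ∈ upTri n) : U.toBlock S (fun a => ¬ S a) = 0 := by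
  ext ⟨a, ha⟩ ⟨b, hb⟩
  exact hU a b (lt_of_not_ge fun hab => hb (hS hab ha))

theorem toBlock_eq_zero_of_mem_loTri {n : ℕ} {S : Fin n → Prop} (hS : Monotone S) {L : Mn n}
    (hL : L ∈ loTri n) : L.toBlock (fun a => ¬ S a) S = 0 := by
  ext ⟨a, ha⟩ ⟨b, hb⟩
  exact hL a b (lt_of_not_ge fun hab => ha (hS hab hb))

/-- Transversality of `𝔟⁺` and `Ad(p)𝔟⁻` forces the trailing principal blocks of `p`
to be invertible. -/
theorem det_toBlock_ne_zero {n : ℕ} {S : Fin n → Prop} [DecidablePred S] (hS : Monotone S)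
    {p : Mn n} (hp : p.det = 1)
    (hspan : ∀ M ∈ slSub n, ∃ U ∈ upTri n, ∃ L ∈ loTri n, M * p = U * p + p * L) :
    (p.toBlock S S).det ≠ 0 := by
  intro hdet
  obtain ⟨v, hv0, hv⟩ := Matrix.exists_mulVec_eq_zero_iff.mpr hdet
  obtain ⟨w, hw0, hw⟩ := Matrix.exists_vecMul_eq_zero_iff.mpr hdet
  set x := p.toBlock (fun a => ¬ S a) S *ᵥ v with hx
  have hx0 : x ≠ 0 := by
    intro hx0
    have h := Matrix.toBlock_mul_eq_add S S S p⁻¹ p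
    rw [inv_mul_of_det_one hp, Matrix.toBlock_one_self] at h
    have h' := congrArg (· *ᵥ v) h
    simp only [Matrix.one_mulVec, Matrix.add_mulVec, ← Matrix.mulVec_mulVec] at h'
    rw [hv, ← hx, hx0] at h'
    exact hv0 (by simpa using h')
  obtain ⟨a, ha⟩ := Function.ne_iff.mp hw0
  obtain ⟨b, hb⟩ := Function.ne_iff.mp hx0
  have hab : (a : Fin n) ≠ b := fun h => b.2 (h ▸ a.2)
  obtain ⟨U, hU, L, hL, hM⟩ := hspan (Matrix.single (a : Fin n) (b : Fin n) 1)
    (Matrix.trace_single_eq_of_ne _ _ _ hab)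
  have h := congrArg (fun N : Mn n => w ⬝ᵥ (N.toBlock S S *ᵥ v)) hM
  have hadd : (U * p + p * L).toBlock S S = (U * p).toBlock S S + (p * L).toBlock S S := rfl
  simp only [hadd, Matrix.toBlock_mul_eq_add S S S, toBlock_eq_zero_of_mem_upTri hS hU,
    toBlock_eq_zero_of_mem_loTri hS hL, Matrix.add_mulVec, ← Matrix.mulVec_mulVec, hv, ← hx,
    Matrix.zero_mulVec, Matrix.mulVec_zero, zero_add, add_zero, Matrix.dotProduct_mulVec, hw] at h
  have hs : (Matrix.single (a : Fin n) (b : Fin n) (1 : ℝ)).toBlock S (fun a => ¬ S a)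
      = Matrix.single a b 1 := by
    ext i j
    simp [Matrix.toBlock_apply, Matrix.single_apply, Subtype.ext_iff]
  rw [hs, ← Matrix.dotProduct_mulVec] at h
  have hsingle : w ⬝ᵥ Pi.single a (x b) = 0 := by
    simpa [Matrix.single_mulVec, Pi.single] using h
  rw [dotProduct_single] at hsingle
  exact mul_ne_zero ha hb hsingle

theorem sum_diag_eq {n : ℕ} {S : Fin n → Prop} [DecidablePred S] (hS : Monotone S)
    {p U L : Mn n} (hp : (p.toBlock S S).det ≠ 0) (hU : U ∈ upTri n) (hL : L ∈ loTri n)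
    (h : U * p = p * L) : ∑ a with S a, U a a = ∑ a with S a, L a a := by
  have h' := congrArg (fun N : Mn n => N.toBlock S S) h
  simp only [Matrix.toBlock_mul_eq_add S S S, toBlock_eq_zero_of_mem_upTri hS hU,
    toBlock_eq_zero_of_mem_loTri hS hL, add_zero, Matrix.zero_mul, Matrix.mul_zero] at h'
  have hu : IsUnit (p.toBlock S S).det := isUnit_iff_ne_zero.mpr hp
  have ht : (U.toBlock S S).trace = (L.toBlock S S).trace := by
    calc (U.toBlock S S).trace
        = (U.toBlock S S * p.toBlock S S * (p.toBlock S S)⁻¹).trace := by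
          rw [Matrix.mul_nonsing_inv_cancel_right _ _ hu]
      _ = (L.toBlock S S).trace := by
          rw [h', Matrix.trace_mul_cycle, Matrix.nonsing_inv_mul _ hu, one_mul]
  simpa [Matrix.trace, Finset.sum_subtype (Finset.univ.filter S) (p := S) (by simp)] using ht

theorem diag_eq_of_intertwined {n : ℕ} {p U L : Mn n} (hp : p.det = 1)
    (hspan : ∀ M ∈ slSub n, ∃ U ∈ upTri n, ∃ L ∈ loTri n, M * p = U * p + p * L)
    (hU : U ∈ upTri n) (hL : L ∈ loTri n) (h : U * p = p * L) (k : Fin n) :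
    U k k = L k k := by
  have hle : Monotone fun a => k ≤ a := fun _ _ hab hka => le_trans hka hab
  have hlt : Monotone fun a => k < a := fun _ _ hab hka => lt_of_lt_of_le hka hab
  have e₁ := sum_diag_eq hle (det_toBlock_ne_zero hle hp hspan) hU hL h
  have e₂ := sum_diag_eq hlt (det_toBlock_ne_zero hlt hp hspan) hU hL h
  have hf : (Finset.univ.filter fun a => k ≤ a) = insert k (Finset.univ.filter fun a => k < a) := by
    ext a
    simp [le_iff_eq_or_lt, eq_comm]
  rw [hf, Finset.sum_insert (by simp), Finset.sum_insert (by simp), e₂] at e₁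
  exact add_right_cancel e₁

theorem nustar_eq_of_mem {n : ℕ} {h k : Mn n} (hh : h.det = 1) (hk : k.det = 1)
    (ht : Transv ((bplus n).map (AdM h)) ((bminus n).map (AdM k))) {Z : Mn n}
    (hZ₁ : Z ∈ (bplus n).map (AdM h)) (hZ₂ : Z ∈ (bminus n).map (AdM k)) :
    nustar h Z = nustar k Z := by
  rw [nustar_apply hh, nustar_apply hk]
  rw [mem_map_AdM_iff hh] at hZ₁
  rw [mem_map_AdM_iff hk] at hZ₂
  have hp : (h⁻¹ * k).det = 1 := by simp [Matrix.det_nonsing_inv, hh, hk]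
  congr 1
  funext i
  refine diag_eq_of_intertwined hp ?_ hZ₁.2 hZ₂.2 ?_ i
  · intro M hM
    have hmem := conj_mem_slSub hh hM
    rw [← ht] at hmem
    obtain ⟨_, ⟨U, hU, rfl⟩, _, ⟨L, hL, rfl⟩, hsum⟩ := Submodule.mem_sup.mp hmem
    refine ⟨U, hU.2, L, hL.2, ?_⟩
    have hsum' : h * U * h⁻¹ + k * L * k⁻¹ = h * M * h⁻¹ := hsum
    have hc := congrArg (fun N => h⁻¹ * N * k) hsum'
    calc M * (h⁻¹ * k) = (h⁻¹ * h) * M * (h⁻¹ * k) := by rw [inv_mul_of_det_one hh, one_mul]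
      _ = h⁻¹ * (h * M * h⁻¹) * k := by noncomm_ring
      _ = (h⁻¹ * h) * U * (h⁻¹ * k) + (h⁻¹ * k) * L * (k⁻¹ * k) := by rw [← hc]; noncomm_ring
      _ = _ := by rw [inv_mul_of_det_one hh, inv_mul_of_det_one hk, one_mul, mul_one]
  · calc h⁻¹ * Z * h * (h⁻¹ * k) = h⁻¹ * Z * (h * h⁻¹) * k := by noncomm_ring
      _ = h⁻¹ * (k * k⁻¹) * Z * k := by
        rw [mul_inv_of_det_one hh, mul_inv_of_det_one hk]; simp
      _ = h⁻¹ * k * (k⁻¹ * Z * k) := by noncomm_ring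

theorem nustar_eq_of_isStd {n : ℕ} {h k : Mn n} {V W : Submodule ℝ (Mn n)}
    (ht : Transv V W) (hh : IsStd h V W) (hk : IsStd k V W) {Z : Mn n} (hZ : Z ∈ slSub n) :
    nustar h Z = nustar k Z := by
  obtain ⟨hh, rfl, rfl⟩ := hh
  obtain ⟨hk, hV, hW⟩ := hk
  rw [nustar_apply hh, nustar_apply hk]
  congr 1
  funext i
  set D : Mn n := Matrix.diagonal fun j => (if j = i then (1 : ℝ) else 0) - (n : ℝ)⁻¹ with hD
  have hn : (n : ℝ) ≠ 0 := by
    have := i.pos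
    positivity
  have hDtr : D ∈ slSub n := by
    rw [mem_slSub]
    simp [hD, Matrix.trace_diagonal, hn]
  have hDu : D ∈ upTri n := fun a b hab => Matrix.diagonal_apply_ne _ hab.ne'
  have hDl : D ∈ loTri n := fun a b hab => Matrix.diagonal_apply_ne _ hab.ne
  have hinv : h⁻¹ * (h * D * h⁻¹) * h = D := by
    calc h⁻¹ * (h * D * h⁻¹) * h = (h⁻¹ * h) * D * (h⁻¹ * h) := by noncomm_ring
      _ = D := by simp [inv_mul_of_det_one hh]
  have hmV : h * D * h⁻¹ ∈ (bplus n).map (AdM h) := ⟨D, ⟨hDtr, hDu⟩, rfl⟩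
  have hmW : h * D * h⁻¹ ∈ (bminus n).map (AdM h) := ⟨D, ⟨hDtr, hDl⟩, rfl⟩
  have hkV := (mem_map_AdM_iff hk _ _).mp (hV.symm ▸ hmV)
  have hkW := (mem_map_AdM_iff hk _ _).mp (hW.symm ▸ hmW)
  have heq := nustar_eq_of_mem hh hk (hW.symm ▸ ht) hmV (hW.symm ▸ hmW)
  rw [nustar_apply hh, nustar_apply hk, hinv] at heq
  have hconj : k⁻¹ * (h * D * h⁻¹) * k = D := by
    ext a b
    rcases lt_trichotomy a b with hab | rfl | hab
    · rw [hkW.2 a b hab, hDl a b hab]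
    · simpa using (congrFun (congrFun heq a) a).symm
    · rw [hkV.2 a b hab, hDu a b hab]
  have hkD : h * D * h⁻¹ = k * D * k⁻¹ := by
    calc h * D * h⁻¹ = (k * k⁻¹) * (h * D * h⁻¹) * (k * k⁻¹) := by
          simp [mul_inv_of_det_one hk]
      _ = k * (k⁻¹ * (h * D * h⁻¹) * k) * k⁻¹ := by noncomm_ring
      _ = _ := by rw [hconj]
  have htrace : ∀ g : Mn n, g.det = 1 → (g * D * g⁻¹ * Z).trace = (g⁻¹ * Z * g) i i := by
    intro g hg
    have hz : (g⁻¹ * Z * g).trace = 0 := by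
      rw [Matrix.trace_mul_cycle, mul_inv_of_det_one hg, one_mul]
      exact hZ
    calc (g * D * g⁻¹ * Z).trace = (D * (g⁻¹ * Z * g)).trace := by
          rw [Matrix.mul_assoc, Matrix.mul_assoc, Matrix.trace_mul_comm]
          simp only [Matrix.mul_assoc]
      _ = (g⁻¹ * Z * g) i i - (n : ℝ)⁻¹ * (g⁻¹ * Z * g).trace := by
          simp only [Matrix.trace, Matrix.diag_apply, hD, Matrix.diagonal_mul, sub_mul,
            Finset.sum_sub_distrib, Finset.mul_sum]
          simp
      _ = _ := by rw [hz, mul_zero, sub_zero]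
  rw [← htrace h hh, ← htrace k hk, hkD]

theorem inter_nonempty {n : ℕ} {A B : Set (Mn n)} {V W : Submodule ℝ (Mn n)}
    (hA : IsAffPara A V) (hB : IsAffPara B W) (ht : Transv V W) : (A ∩ B).Nonempty := by
  obtain ⟨-, X, hX, rfl⟩ := hA
  obtain ⟨-, Y, hY, rfl⟩ := hB
  have hXY := (slSub n).sub_mem hX hY
  rw [← ht] at hXY
  obtain ⟨v, hv, w, hw, hvw⟩ := Submodule.mem_sup.mp hXY
  refine ⟨X - v, ?_, ?_⟩
  · simpa using hv
  · have : X - v - Y = w := by rw [sub_right_comm, ← hvw, add_sub_cancel_left]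
    simpa [this] using hw

theorem IsAffPara.sub_mem {n : ℕ} {A : Set (Mn n)} {V : Submodule ℝ (Mn n)}
    (hA : IsAffPara A V) {X Y : Mn n} (hX : X ∈ A) (hY : Y ∈ A) : X - Y ∈ V := by
  obtain ⟨-, Z, -, rfl⟩ := hA
  simpa using V.sub_mem hX hY

theorem IsAffPara.mem_slSub {n : ℕ} {A : Set (Mn n)} {V : Submodule ℝ (Mn n)}
    (hA : IsAffPara A V) (hV : V ≤ slSub n) {X : Mn n} (hX : X ∈ A) : X ∈ slSub n := by
  obtain ⟨-, Z, hZ, rfl⟩ := hA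
  simpa using (slSub n).add_mem (hV hX) hZ

/-- Let A₁, A₂, A₃, A₄ be pairwise transverse affine parabolic spaces in
𝔰𝔩ₙ(ℝ) with directions V₁, V₂, V₃, V₄. Then A₁ ∩ A₃ and A₂ ∩ A₄ are nonempty, and the
value β(A₁,A₂,A₃,A₄) = (ν*_{1,4} − ν*_{2,3})(X₁,₃ − X₂,₄) is independent of the choice of
points X₁,₃ ∈ A₁ ∩ A₃, X₂,₄ ∈ A₂ ∩ A₄ and of the standardizers of (V₁,V₄) and (V₂,V₃):
the affine cross ratio is well defined. -/
theorem affine_cross_ratio_well_defined (n : ℕ) (hn : 2 ≤ n)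
    (A₁ A₂ A₃ A₄ : Set (Mn n)) (V₁ V₂ V₃ V₄ : Submodule ℝ (Mn n))
    (h₁ : IsAffPara A₁ V₁) (h₂ : IsAffPara A₂ V₂)
    (h₃ : IsAffPara A₃ V₃) (h₄ : IsAffPara A₄ V₄)
    (t₁₂ : Transv V₁ V₂) (t₁₃ : Transv V₁ V₃) (t₁₄ : Transv V₁ V₄)
    (t₂₃ : Transv V₂ V₃) (t₂₄ : Transv V₂ V₄) (t₃₄ : Transv V₃ V₄) :
    (A₁ ∩ A₃).Nonempty ∧ (A₂ ∩ A₄).Nonempty ∧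
    ∀ b b' : Mn n, IsCross b A₁ A₂ A₃ A₄ V₁ V₂ V₃ V₄ →
      IsCross b' A₁ A₂ A₃ A₄ V₁ V₂ V₃ V₄ → b = b' := by
  refine ⟨inter_nonempty h₁ h₃ t₁₃, inter_nonempty h₂ h₄ t₂₄, ?_⟩
  rintro _ _ ⟨p, q, X, Y, hp, hq, hX, hY, rfl⟩ ⟨p', q', X', Y', hp', hq', hX', hY', rfl⟩
  have hsl : X' - Y' ∈ slSub n := (slSub n).sub_mem
    (h₁.mem_slSub (le_sup_left.trans_eq t₁₂) hX'.1) (h₂.mem_slSub (le_sup_left.trans_eq t₂₃) hY'.1)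
  rw [← nustar_eq_of_isStd t₁₄ hp hp' hsl, ← nustar_eq_of_isStd t₂₃ hq hq' hsl]
  obtain ⟨hp, rfl, rfl⟩ := hp
  obtain ⟨hq, rfl, rfl⟩ := hq
  have e₁ := nustar_eq_of_mem hp hq t₁₃ (h₁.sub_mem hX.1 hX'.1) (h₃.sub_mem hX.2 hX'.2)
  have e₂ := nustar_eq_of_mem hq hp t₂₄ (h₂.sub_mem hY.1 hY'.1) (h₄.sub_mem hY.2 hY'.2)
  simp only [map_sub] at e₁ e₂ ⊢
  linear_combination (norm := module) e₁ + e₂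

end
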